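/- arXiv:2505.06446 — 10 statements merged into one kernel-verified Lean document; each statement's English description precedes it below -/
import Mathlib

section
/- Let k ≥ 1 and let (f_y)_{y∈{−1,1}^k} be a collection of polymatroids on 2^{[k]}, with L the associated Lovász hinge. Then for every v ∈ {−1,0,1}^k and every y ∈ {−1,1}^k, L(v,y) = f_y(mis(v,y) \ abs(v)) + f_y(mis(v,y)). (That is, the Lovász hinge restricted to {−1,0,1}^k equals the structured abstain loss ℓ_abs.) -/
open Finset
open scoped Classical

noncomputable section

/-- The set `{π_1, …, π_i}` of the first `i` elements under the permutation `π`. -/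
def chain (k : ℕ) (π : Equiv.Perm (Fin k)) (i : ℕ) : Finset (Fin k) :=
  (Finset.univ.filter (fun j : Fin k => (j : ℕ) < i)).image π

/-- The Lovász extension of the set function `f`. -/
def lovaszExt (k : ℕ) (f : Finset (Fin k) → ℝ) (x : Fin k → ℝ) : ℝ :=
  Finset.univ.sup' ⟨1, Finset.mem_univ 1⟩
    (fun π : Equiv.Perm (Fin k) =>
      ∑ i : Fin k, x (π i) * (f (chain k π ((i : ℕ) + 1)) - f (chain k π (i : ℕ))))

/-- A polymatroid: normalized, increasing, submodular. -/
def IsPolymatroid (k : ℕ) (f : Finset (Fin k) → ℝ) : Prop :=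
  f ∅ = 0 ∧
  (∀ S T : Finset (Fin k), Disjoint S T → f S ≤ f (S ∪ T)) ∧
  (∀ S T : Finset (Fin k), f (S ∪ T) + f (S ∩ T) ≤ f S + f T)

def IsSign (k : ℕ) (y : Fin k → ℝ) : Prop := ∀ i, y i = 1 ∨ y i = -1

def IsV (k : ℕ) (v : Fin k → ℝ) : Prop := ∀ i, v i = -1 ∨ v i = 0 ∨ v i = 1

/-- The finite set of sign vectors `{-1,1}^k`. -/
def signVecs (k : ℕ) : Finset (Fin k → ℝ) :=
  Finset.image (fun s : Fin k → Bool => fun i => if s i then (1 : ℝ) else -1) Finset.univ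

def misSet (k : ℕ) (v y : Fin k → ℝ) : Finset (Fin k) :=
  Finset.univ.filter (fun i => v i ≠ y i)

def absSet (k : ℕ) (v : Fin k → ℝ) : Finset (Fin k) :=
  Finset.univ.filter (fun i => v i = 0)

/-- The Lovász hinge for a label-indexed collection of set functions. -/
def hinge (k : ℕ) (f : (Fin k → ℝ) → Finset (Fin k) → ℝ) (u y : Fin k → ℝ) : ℝ :=
  lovaszExt k (f y) (fun i => max (1 - u i * y i) 0)

def clip (k : ℕ) (u : Fin k → ℝ) : Fin k → ℝ := fun i => Real.sign (u i) * min |u i| 1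

def indVec (k : ℕ) (π : Equiv.Perm (Fin k)) (i : ℕ) : Fin k → ℝ :=
  fun j => if j ∈ chain k π i then 1 else 0

def Vpy (k : ℕ) (π : Equiv.Perm (Fin k)) (y : Fin k → ℝ) : Set (Fin k → ℝ) :=
  { x | ∃ i ≤ k, x = fun j => indVec k π i j * y j }

def Ppy (k : ℕ) (π : Equiv.Perm (Fin k)) (y : Fin k → ℝ) : Set (Fin k → ℝ) :=
  convexHull ℝ (Vpy k π y)

def psiHat (k : ℕ) (ε : ℝ) (u : Fin k → ℝ) : Set (Fin k → ℝ) :=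
  ⋂₀ { V : Set (Fin k → ℝ) |
      (∃ (π : Equiv.Perm (Fin k)) (y : Fin k → ℝ), IsSign k y ∧ V ⊆ Vpy k π y) ∧
      EMetric.infEdist (clip k u) (convexHull ℝ V) < ENNReal.ofReal ε }

def mval (k : ℕ) (ε : ℝ) (u : Fin k → ℝ) (π : Equiv.Perm (Fin k)) : ℕ → ℝ :=
  fun i => if i = 0 then 1 + ε
    else if h : i ≤ k ∧ 1 ≤ k then |u (π ⟨i - 1, by omega⟩)| else -ε



theorem mem_chain {k : ℕ} {π : Equiv.Perm (Fin k)} {i : ℕ} {a : Fin k} :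
    a ∈ chain k π i ↔ (π.symm a : ℕ) < i := by
  simp only [chain, mem_image, mem_filter, mem_univ, true_and]
  constructor
  · rintro ⟨j, hj, rfl⟩
    simpa using hj
  · intro h
    exact ⟨π.symm a, h, π.apply_symm_apply a⟩

theorem chain_succ {k : ℕ} (π : Equiv.Perm (Fin k)) (i : Fin k) :
    chain k π ((i : ℕ) + 1) = insert (π i) (chain k π i) := by
  ext a
  rw [mem_insert, mem_chain, mem_chain, Nat.lt_succ_iff_lt_or_eq, or_comm, Fin.val_inj,
    Equiv.symm_apply_eq]

/-- Intersecting a maximal chain with `S` gives increments that sum to `f S`. -/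
theorem sum_chain_inter_sub {k : ℕ} {f : Finset (Fin k) → ℝ} (h0 : f ∅ = 0)
    (π : Equiv.Perm (Fin k)) (S : Finset (Fin k)) :
    ∑ i : Fin k, (f (chain k π ((i : ℕ) + 1) ∩ S) - f (chain k π i ∩ S)) = f S := by
  rw [Fin.sum_univ_eq_sum_range
    (fun i => f (chain k π (i + 1) ∩ S) - f (chain k π i ∩ S)) k, Finset.sum_range_sub
    (fun i => f (chain k π i ∩ S))]
  have hk : chain k π k = univ := by
    ext a
    simp [mem_chain]
  have hz : chain k π 0 = ∅ := by
    ext a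
    simp [mem_chain]
  simp [hk, hz, h0]

theorem sum_indicator_chain_le {k : ℕ} {f : Finset (Fin k) → ℝ} (hf : IsPolymatroid k f)
    (π : Equiv.Perm (Fin k)) (S : Finset (Fin k)) :
    ∑ i : Fin k, (if π i ∈ S then (1 : ℝ) else 0) *
      (f (chain k π ((i : ℕ) + 1)) - f (chain k π i)) ≤ f S := by
  rw [← sum_chain_inter_sub hf.1 π S]
  refine Finset.sum_le_sum fun i _ => ?_
  split_ifs with h
  · have hsub := hf.2.2 (chain k π ((i : ℕ) + 1) ∩ S) (chain k π i)
    have hunion : chain k π ((i : ℕ) + 1) ∩ S ∪ chain k π i = chain k π ((i : ℕ) + 1) := by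
      rw [chain_succ]
      grind
    have hinter : chain k π ((i : ℕ) + 1) ∩ S ∩ chain k π i = chain k π i ∩ S := by
      rw [chain_succ]
      grind
    rw [hunion, hinter] at hsub
    linarith
  · rw [chain_succ, Finset.insert_inter_of_notMem h]
    simp

theorem sum_indicator_chain_eq {k : ℕ} {f : Finset (Fin k) → ℝ} (h0 : f ∅ = 0)
    (π : Equiv.Perm (Fin k)) (S : Finset (Fin k))
    (hS : ∀ i j, j ≤ i → π i ∈ S → π j ∈ S) :
    ∑ i : Fin k, (if π i ∈ S then (1 : ℝ) else 0) *
      (f (chain k π ((i : ℕ) + 1)) - f (chain k π i)) = f S := by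
  rw [← sum_chain_inter_sub h0 π S]
  refine Finset.sum_congr rfl fun i _ => ?_
  split_ifs with h
  · have hsub : chain k π ((i : ℕ) + 1) ⊆ S := fun a ha => by
      simpa using hS i (π.symm a) (Nat.lt_succ_iff.1 (mem_chain.1 ha)) h
    have hsub' : chain k π i ⊆ S :=
      ((Finset.subset_insert _ _).trans (chain_succ π i).ge).trans hsub
    rw [Finset.inter_eq_left.2 hsub, Finset.inter_eq_left.2 hsub', one_mul]
  · rw [chain_succ, Finset.insert_inter_of_notMem h]
    simp

/-- The Lovász extension at a sum of indicators of nested sets `A ⊆ M`. -/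
theorem lovaszExt_indicator_add_indicator {k : ℕ} {f : Finset (Fin k) → ℝ}
    (hf : IsPolymatroid k f) {A M : Finset (Fin k)} (hAM : A ⊆ M) :
    lovaszExt k f (fun i => (if i ∈ A then (1 : ℝ) else 0) + if i ∈ M then (1 : ℝ) else 0) =
      f A + f M := by
  unfold lovaszExt
  simp only [add_mul, Finset.sum_add_distrib]
  apply le_antisymm
  · exact Finset.sup'_le _ _ fun π _ =>
      add_le_add (sum_indicator_chain_le hf π A) (sum_indicator_chain_le hf π M)
  · let g : Fin k → ℕ := fun i => if i ∈ A then 0 else if i ∈ M then 1 else 2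
    have hg : Monotone (g ∘ Tuple.sort g) := Tuple.monotone_sort g
    have hA : ∀ i j, j ≤ i → Tuple.sort g i ∈ A → Tuple.sort g j ∈ A := by
      intro i j hji hi
      have hle : g (Tuple.sort g j) ≤ g (Tuple.sort g i) := hg hji
      grind
    have hM : ∀ i j, j ≤ i → Tuple.sort g i ∈ M → Tuple.sort g j ∈ M := by
      intro i j hji hi
      have hle : g (Tuple.sort g j) ≤ g (Tuple.sort g i) := hg hji
      grind
    refine le_trans (le_of_eq ?_) (Finset.le_sup' _ (Finset.mem_univ (Tuple.sort g)))
    exact (congrArg₂ (· + ·) (sum_indicator_chain_eq hf.1 _ A hA)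
      (sum_indicator_chain_eq hf.1 _ M hM)).symm

/-- The Lovász hinge restricted to `{-1,0,1}^k` equals the structured
abstain loss `ℓ_abs`. -/
theorem lovasz_hinge_restrict_eq_structured_abstain
    (k : ℕ) (hk : 1 ≤ k) (f : (Fin k → ℝ) → Finset (Fin k) → ℝ)
    (hf : ∀ y : Fin k → ℝ, IsSign k y → IsPolymatroid k (f y))
    (v y : Fin k → ℝ) (hv : IsV k v) (hy : IsSign k y) :
    hinge k f v y = f y (misSet k v y \ absSet k v) + f y (misSet k v y) := by
  rw [← lovaszExt_indicator_add_indicator (hf y hy) Finset.sdiff_subset, hinge]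
  congr 1
  funext i
  simp only [misSet, absSet, mem_sdiff, mem_filter, mem_univ, true_and]
  rcases hv i with h | h | h <;> rcases hy i with h' | h' <;> rw [h, h'] <;> norm_num

end
end

section
/- Let k ≥ 1 and let (f_y)_{y∈{−1,1}^k} be a collection of polymatroids on 2^{[k]}, with L the associated Lovász hinge. Then for every u ∈ ℝ^k and every y ∈ {−1,1}^k, L(clip(u), y) ≤ L(u, y). -/
open Finset
open scoped Classical

noncomputable section

theorem chain_mono (k : ℕ) (π : Equiv.Perm (Fin k)) : Monotone (chain k π) := by
  intro i j hij
  refine Finset.image_subset_image fun a ha => ?_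
  simp only [Finset.mem_filter, Finset.mem_univ, true_and] at ha ⊢
  omega

theorem IsPolymatroid.monotone {k : ℕ} {f : Finset (Fin k) → ℝ} (hf : IsPolymatroid k f) :
    Monotone f := by
  intro S T hST
  have h := hf.2.1 S (T \ S) Finset.disjoint_sdiff
  rwa [Finset.union_sdiff_of_subset hST] at h

/-- The Lovász extension of a monotone set function is monotone. -/
theorem lovaszExt_mono {k : ℕ} {f : Finset (Fin k) → ℝ} (hf : Monotone f) :
    Monotone (lovaszExt k f) := by
  intro x z hxz
  refine Finset.sup'_mono_fun fun π _ => Finset.sum_le_sum fun i _ => ?_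
  exact mul_le_mul_of_nonneg_right (hxz _)
    (sub_nonneg.2 (hf (chain_mono k π (Nat.le_succ _))))

theorem clip_apply_eq (k : ℕ) (u : Fin k → ℝ) (i : Fin k) :
    clip k u i = max (-1) (min (u i) 1) := by
  unfold clip
  rcases lt_trichotomy (u i) 0 with h | h | h
  · rw [Real.sign_of_neg h, abs_of_neg h, min_eq_left (by linarith : u i ≤ 1)]
    rcases le_total (-u i) 1 with h1 | h1
    · rw [min_eq_left h1, max_eq_right (by linarith)]; ring
    · rw [min_eq_right h1, max_eq_left (by linarith)]; ring
  · simp [h]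
  · rw [Real.sign_of_pos h, abs_of_pos h, one_mul, max_eq_right]
    exact le_min (by linarith) (by norm_num)

/-- Clipping to `[-1,1]^k` never increases the Lovász hinge. -/
theorem clip_dominates
    (k : ℕ) (hk : 1 ≤ k) (f : (Fin k → ℝ) → Finset (Fin k) → ℝ)
    (hf : ∀ y : Fin k → ℝ, IsSign k y → IsPolymatroid k (f y))
    (u y : Fin k → ℝ) (hy : IsSign k y) :
    hinge k f (clip k u) y ≤ hinge k f u y := by
  refine lovaszExt_mono (hf y hy).monotone fun i => ?_
  simp only [clip_apply_eq]
  rcases hy i with h | h <;> rw [h] <;> grind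

end
end

section
/- Let k ≥ 1 and let f be a polymatroid on 2^{[k]}. Then for every v ∈ {−1,0,1}^k, ℓ_abs(v; p̄) ≥ f([k]), and for every r ∈ {−1,1}^k, ℓ_abs(r; p̄) = 2·f̄, where f̄ = 2^{−k} ∑_{S⊆[k]} f(S). -/
open Finset
open scoped Classical

noncomputable section

lemma mem_signVecs {k : ℕ} {y : Fin k → ℝ} : y ∈ signVecs k ↔ IsSign k y := by
  simp only [signVecs, mem_image, mem_univ, true_and]
  constructor
  · rintro ⟨s, rfl⟩ i
    cases h : s i <;> simp [h]
  · intro h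
    refine ⟨fun i => decide (y i = 1), funext fun i => ?_⟩
    rcases h i with h | h <;> norm_num [h]

lemma card_signVecs (k : ℕ) : (signVecs k).card = 2 ^ k := by
  rw [signVecs, card_image_of_injective]
  · simp
  · intro s t h
    funext i
    have hi := congrFun h i
    cases hs : s i <;> cases ht : t i <;> norm_num [hs, ht] at hi <;> rfl

lemma IsSign.neg {k : ℕ} {y : Fin k → ℝ} (hy : IsSign k y) : IsSign k (-y) := by
  intro i
  rcases hy i with h | h <;> simp [h]

lemma sum_signVecs_neg {k : ℕ} (g : (Fin k → ℝ) → ℝ) :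
    ∑ y ∈ signVecs k, g (-y) = ∑ y ∈ signVecs k, g y :=
  sum_nbij' (fun y => -y) (fun y => -y)
    (fun _ hy => mem_signVecs.2 (mem_signVecs.1 hy).neg)
    (fun _ hy => mem_signVecs.2 (mem_signVecs.1 hy).neg)
    (fun _ _ => neg_neg _) (fun _ _ => neg_neg _) (fun _ _ => rfl)

lemma misSet_sdiff_absSet_union_misSet_neg {k : ℕ} {v y : Fin k → ℝ} (hy : IsSign k y) :
    (misSet k v y \ absSet k v) ∪ misSet k v (-y) = univ := by
  ext i
  simp only [misSet, absSet, mem_union, mem_sdiff, mem_filter, mem_univ, true_and, iff_true,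
    Pi.neg_apply]
  rcases hy i with h | h <;> rw [h] <;> by_contra! hc <;>
    · have h1 := hc.2
      norm_num [h1] at hc

lemma misSet_sdiff_absSet_inter_misSet_neg {k : ℕ} {v y : Fin k → ℝ} (hv : IsV k v)
    (hy : IsSign k y) : (misSet k v y \ absSet k v) ∩ misSet k v (-y) = ∅ := by
  ext i
  simp only [misSet, absSet, mem_inter, mem_sdiff, mem_filter, mem_univ, true_and,
    Pi.neg_apply, notMem_empty, iff_false]
  rcases hy i with h | h <;> rcases hv i with h' | h' | h' <;> norm_num [h, h']

lemma IsPolymatroid.univ_le_misSet {k : ℕ} {f : Finset (Fin k) → ℝ} (hf : IsPolymatroid k f)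
    {v y : Fin k → ℝ} (hv : IsV k v) (hy : IsSign k y) :
    f univ ≤ f (misSet k v y \ absSet k v) + f (misSet k v (-y)) := by
  have h := hf.2.2 (misSet k v y \ absSet k v) (misSet k v (-y))
  rwa [misSet_sdiff_absSet_union_misSet_neg hy, misSet_sdiff_absSet_inter_misSet_neg hv hy,
    hf.1, add_zero] at h

lemma absSet_eq_empty {k : ℕ} {r : Fin k → ℝ} (hr : IsSign k r) : absSet k r = ∅ := by
  ext i
  rcases hr i with h | h <;> simp [absSet, h]

lemma sum_misSet {k : ℕ} {r : Fin k → ℝ} (hr : IsSign k r) (g : Finset (Fin k) → ℝ) :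
    ∑ y ∈ signVecs k, g (misSet k r y) = ∑ S, g S := by
  refine sum_nbij' (fun y => misSet k r y) (fun S i => if i ∈ S then -r i else r i)
    (fun _ _ => mem_univ _) (fun S _ => mem_signVecs.2 fun i => ?_)
    (fun y hy => funext fun i => ?_) (fun S _ => ?_) (fun _ _ => rfl)
  · rcases hr i with h | h <;> by_cases hS : i ∈ S <;> simp [h, hS]
  · rcases hr i with h | h <;> rcases mem_signVecs.1 hy i with h' | h' <;>
      norm_num [misSet, h, h']
  · ext i
    rcases hr i with h | h <;> by_cases hS : i ∈ S <;> norm_num [misSet, h, hS]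

/-- Under the uniform distribution `p̄` on `{-1,1}^k`, every
`v ∈ {-1,0,1}^k` has expected structured abstain loss at least `f([k])`, and every
`r ∈ {-1,1}^k` has expected structured abstain loss exactly `2·f̄`. -/
theorem labs_uniform_bounds (k : ℕ) (hk : 1 ≤ k) (f : Finset (Fin k) → ℝ)
    (hf : IsPolymatroid k f) :
    (∀ v : Fin k → ℝ, IsV k v →
      f Finset.univ ≤ ∑ y ∈ signVecs k, ((2:ℝ)^k)⁻¹ *
        (f (misSet k v y \ absSet k v) + f (misSet k v y))) ∧
    (∀ r : Fin k → ℝ, IsSign k r →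
      ∑ y ∈ signVecs k, ((2:ℝ)^k)⁻¹ * (f (misSet k r y \ absSet k r) + f (misSet k r y))
        = 2 * (((2:ℝ)^k)⁻¹ * ∑ S : Finset (Fin k), f S)) := by
  refine ⟨fun v hv => ?_, fun r hr => ?_⟩
  · rw [← mul_sum, sum_add_distrib, ← sum_signVecs_neg (fun y => f (misSet k v y)),
      ← sum_add_distrib, le_inv_mul_iff₀ (by positivity)]
    have h := card_nsmul_le_sum (signVecs k) _ _
      fun y hy => hf.univ_le_misSet hv (mem_signVecs.1 hy)
    rwa [card_signVecs, nsmul_eq_mul, Nat.cast_pow, Nat.cast_ofNat] at h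
  · simp only [absSet_eq_empty hr, sdiff_empty]
    rw [← mul_sum, sum_add_distrib, sum_misSet hr]
    ring

end
end

section
/- Let k ≥ 1 and let f be a polymatroid on 2^{[k]}, and set f̄ = 2^{−k} ∑_{S⊆[k]} f(S). Then f̄ ≥ f([k])/2, and f̄ = f([k])/2 if and only if f is modular (i.e., f(S) + f(T) = f(S ∪ T) + f(S ∩ T) for all S, T ⊆ [k]). -/
open Finset
open scoped Classical

noncomputable section

/-- Averaging over complementary pairs: the sum of a set function is half the sum over such pairs. -/
theorem two_mul_sum_eq_sum_add_compl {α : Type*} [Fintype α] [DecidableEq α]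
    (f : Finset α → ℝ) : 2 * ∑ S : Finset α, f S = ∑ S : Finset α, (f S + f Sᶜ) := by
  have h : ∑ S : Finset α, f Sᶜ = ∑ S : Finset α, f S :=
    (compl_involutive (α := Finset α)).bijective.sum_comp f
  rw [Finset.sum_add_distrib, h, two_mul]

/-- A submodular function that is additive on complementary pairs is modular. -/
theorem modular_of_submodular_of_add_compl {α : Type*} [Fintype α] [DecidableEq α]
    {f : Finset α → ℝ} (hsub : ∀ S T, f (S ∪ T) + f (S ∩ T) ≤ f S + f T)
    (hc : ∀ S, f S + f Sᶜ = f Finset.univ) (S T : Finset α) :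
    f S + f T = f (S ∪ T) + f (S ∩ T) := by
  have h := hsub Sᶜ Tᶜ
  rw [← Finset.compl_inter, ← Finset.compl_union] at h
  linarith [hsub S T, hc S, hc T, hc (S ∪ T), hc (S ∩ T)]

/-- For a polymatroid `f`, the average value `f̄ = 2⁻ᵏ ∑_S f(S)` satisfies
`f̄ ≥ f([k])/2`, with equality iff `f` is modular. -/
theorem fbar_ge_half_iff_modular (k : ℕ) (hk : 1 ≤ k) (f : Finset (Fin k) → ℝ)
    (hf : IsPolymatroid k f) :
    f Finset.univ / 2 ≤ ((2:ℝ)^k)⁻¹ * ∑ S : Finset (Fin k), f S ∧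
    (((2:ℝ)^k)⁻¹ * ∑ S : Finset (Fin k), f S = f Finset.univ / 2 ↔
      ∀ S T : Finset (Fin k), f S + f T = f (S ∪ T) + f (S ∩ T)) := by
  obtain ⟨h0, -, hsub⟩ := hf
  have hle (S : Finset (Fin k)) : f Finset.univ ≤ f S + f Sᶜ := by
    simpa [h0] using hsub S Sᶜ
  have hsum := two_mul_sum_eq_sum_add_compl f
  have hconst : ∑ _S : Finset (Fin k), f Finset.univ = 2 ^ k * f Finset.univ := by
    simp
  have hsum_le := Finset.sum_le_sum fun S (_ : S ∈ Finset.univ) => hle S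
  have hpos : (0 : ℝ) < 2 ^ k := by positivity
  refine ⟨?_, ?_⟩
  · rw [le_inv_mul_iff₀ hpos]
    linarith
  · rw [inv_mul_eq_iff_eq_mul₀ hpos.ne']
    constructor
    · intro h
      have heq : ∑ _S : Finset (Fin k), f Finset.univ =
          ∑ S : Finset (Fin k), (f S + f Sᶜ) := by linarith
      rw [Finset.sum_eq_sum_iff_of_le fun S _ => hle S] at heq
      exact modular_of_submodular_of_add_compl hsub fun S => (heq S (Finset.mem_univ S)).symm
    · intro h
      have heq : ∑ S : Finset (Fin k), (f S + f Sᶜ) =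
          ∑ _S : Finset (Fin k), f Finset.univ :=
        Finset.sum_congr rfl fun S _ => by simpa [h0] using h S Sᶜ
      linarith

end
end

section
/- Let k ≥ 1 and for T, S ⊆ [k] define the Jaccard polymatroid J_T(S) = |S| / |S ∪ T|, with the convention 0/0 = 0. Then for every T ⊆ [k], J_T([k]) > J_T(∅), and for all S, T ⊆ [k], J_T(S) + J_{[k]\T}([k]\S) ≥ 1, with strict inequality whenever S ∉ {∅, [k]} and T ∉ {∅, [k]\S, [k]}. (Equivalently, the collection of Jaccard polymatroids satisfies Condition 1.) -/
open Finset
open scoped Classical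

noncomputable section

/-- The Jaccard polymatroid `J_T(S) = |S| / |S ∪ T|` (with the convention `0/0 = 0`,
which is automatic for real division in Lean). -/
def jac (k : ℕ) (T S : Finset (Fin k)) : ℝ := (S.card : ℝ) / ((S ∪ T).card : ℝ)

/-- The Jaccard value of `S` in terms of the sizes of the cells of the Venn diagram of
`S` and `T`. -/
theorem jac_eq_cells (k : ℕ) (S T : Finset (Fin k)) :
    jac k T S = ((S \ T).card + (S ∩ T).card : ℝ) /
      ((S \ T).card + (S ∩ T).card + (T \ S).card) := by
  have hS : (S \ T).card + (S ∩ T).card = S.card := card_sdiff_add_card_inter S T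
  have hST : (T \ S).card + S.card = (S ∪ T).card := by
    rw [card_sdiff_add_card, union_comm]
  have hS' : ((S \ T).card + (S ∩ T).card : ℝ) = S.card := by exact_mod_cast hS
  have hST' : ((T \ S).card + S.card : ℝ) = (S ∪ T).card := by exact_mod_cast hST
  rw [jac, hS', ← hST', add_comm]

theorem jac_compl_eq_cells (k : ℕ) (S T : Finset (Fin k)) :
    jac k Tᶜ Sᶜ = ((T \ S).card + (Sᶜ ∩ Tᶜ).card : ℝ) /
      ((T \ S).card + (Sᶜ ∩ Tᶜ).card + (S \ T).card) := by
  have h₁ : Sᶜ \ Tᶜ = T \ S := by ext; simp [and_comm]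
  have h₂ : Tᶜ \ Sᶜ = S \ T := by ext; simp [and_comm]
  rw [jac_eq_cells, h₁, h₂]

theorem card_sdiff_add_card_compl_inter_compl {k : ℕ} (S T : Finset (Fin k)) :
    (T \ S).card + (Sᶜ ∩ Tᶜ).card = Sᶜ.card := by
  rw [← card_sdiff_add_card_inter Sᶜ Tᶜ]
  congr 2
  ext; simp [and_comm]

theorem one_le_div_add_div_of_cells {a b c d : ℝ} (ha : 0 ≤ a) (hb : 0 ≤ b) (hc : 0 ≤ c)
    (hd : 0 ≤ d) (h : 0 < a + b + c + d) :
    1 ≤ (a + b) / (a + b + c) + (c + d) / (c + d + a) := by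
  rcases (by positivity : 0 ≤ a + b + c).eq_or_lt with h₁ | h₁
  · have ha0 : a = 0 := by linarith
    have hb0 : b = 0 := by linarith
    have hc0 : c = 0 := by linarith
    subst ha0 hb0 hc0
    have hd0 : d ≠ 0 := by intro hd0; simp [hd0] at h
    simp [hd0]
  rcases (by positivity : 0 ≤ c + d + a).eq_or_lt with h₂ | h₂
  · have ha0 : a = 0 := by linarith
    have hc0 : c = 0 := by linarith
    have hd0 : d = 0 := by linarith
    subst ha0 hc0 hd0
    have hb0 : b ≠ 0 := by intro hb0; simp [hb0] at h
    simp [hb0]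
  rw [div_add_div _ _ h₁.ne' h₂.ne', le_div_iff₀ (by positivity)]
  nlinarith [mul_nonneg hc hb, mul_nonneg hd ha, mul_nonneg hd hb]

theorem one_lt_div_add_div_of_cells {a b c d : ℝ} (ha : 0 ≤ a) (hb : 0 ≤ b) (hc : 0 ≤ c)
    (hd : 0 ≤ d) (hab : 0 < a + b) (hcd : 0 < c + d) (hbd : 0 < b + d) :
    1 < (a + b) / (a + b + c) + (c + d) / (c + d + a) := by
  have h₁ : 0 < a + b + c := by linarith
  have h₂ : 0 < c + d + a := by linarith
  have key : 0 < b * (c + d) + d * (a + b) := by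
    rcases hb.eq_or_lt with rfl | hb'
    · have hd' : 0 < d := by linarith
      positivity
    · have := mul_pos hb' hcd
      positivity
  rw [div_add_div _ _ h₁.ne' h₂.ne', lt_div_iff₀ (by positivity)]
  nlinarith [mul_nonneg hc hb, mul_nonneg hd ha, mul_nonneg hd hb]

/-- The Jaccard collection satisfies Condition 1: `J_T([k]) > J_T(∅)`,
and `J_T(S) + J_{[k]∖T}([k]∖S) ≥ 1`, strictly whenever `S ∉ {∅,[k]}` and
`T ∉ {∅, [k]∖S, [k]}`. -/
theorem jaccard_satisfies_condition (k : ℕ) (hk : 1 ≤ k) :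
    (∀ T : Finset (Fin k), jac k T ∅ < jac k T Finset.univ) ∧
    (∀ S T : Finset (Fin k), 1 ≤ jac k T S + jac k Tᶜ Sᶜ) ∧
    (∀ S T : Finset (Fin k), S ≠ ∅ → S ≠ Finset.univ → T ≠ ∅ → T ≠ Sᶜ → T ≠ Finset.univ →
      1 < jac k T S + jac k Tᶜ Sᶜ) := by
  refine ⟨fun T => ?_, fun S T => ?_, fun S T hS hS' _ hTS _ => ?_⟩
  · have hk' : (0 : ℝ) < k := by exact_mod_cast hk
    have hT : (univ ∪ T).card = k := by
      rw [eq_univ_of_forall fun x => mem_union_left T (mem_univ x), card_univ, Fintype.card_fin]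
    simp [jac, hT, hk'.ne']
  · rw [jac_eq_cells, jac_compl_eq_cells]
    refine one_le_div_add_div_of_cells (by positivity) (by positivity) (by positivity)
      (by positivity) ?_
    have h₁ := card_sdiff_add_card_inter S T
    have h₂ := card_sdiff_add_card_compl_inter_compl S T
    have h₃ := card_add_card_compl S
    rw [Fintype.card_fin] at h₃
    exact_mod_cast (by omega : 0 < (S \ T).card + (S ∩ T).card + (T \ S).card + (Sᶜ ∩ Tᶜ).card)
  · rw [jac_eq_cells, jac_compl_eq_cells]
    have h₁ := card_sdiff_add_card_inter S T
    have h₂ := card_sdiff_add_card_compl_inter_compl S T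
    have hSpos : 0 < S.card := card_pos.2 (nonempty_iff_ne_empty.2 hS)
    have hScpos : 0 < Sᶜ.card := by
      rw [card_pos, nonempty_iff_ne_empty]
      simpa [compl_eq_empty_iff] using hS'
    have hbd : 0 < (S ∩ T).card + (Sᶜ ∩ Tᶜ).card := by
      by_contra h0
      have hb : S ∩ T = ∅ := card_eq_zero.1 (by omega)
      have hd : Sᶜ ∩ Tᶜ = ∅ := card_eq_zero.1 (by omega)
      refine hTS (ext fun x => ?_)
      have hbx := Finset.ext_iff.1 hb x
      have hdx := Finset.ext_iff.1 hd x
      simp only [mem_inter, mem_compl, notMem_empty, iff_false] at hbx hdx ⊢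
      tauto
    refine one_lt_div_add_div_of_cells (by positivity) (by positivity) (by positivity)
      (by positivity) ?_ ?_ (by exact_mod_cast hbd)
    · exact_mod_cast h₁ ▸ hSpos
    · exact_mod_cast h₂ ▸ hScpos

end
end

section
/- Let k ≥ 1 and ε > 0. The link envelope Ψ̂(u) is nonempty for every u ∈ ℝ^k if and only if ε ≤ 1/(2k). -/
open Finset
open scoped Classical

noncomputable section

lemma mem_chain_iff {k : ℕ} (π : Equiv.Perm (Fin k)) (i : ℕ) (p : Fin k) :
    π p ∈ chain k π i ↔ (p : ℕ) < i := by
  simp [chain]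

lemma two_coord_le_of_mem_convexHull {ι : Type*} {V : Set (ι → ℝ)} {z : ι → ℝ}
    (hz : z ∈ convexHull ℝ V) (i j : ι) (a b c : ℝ)
    (h : ∀ v ∈ V, a * v i + b * v j ≤ c) : a * z i + b * z j ≤ c := by
  have hlin : IsLinearMap ℝ (fun v : ι → ℝ => a * v i + b * v j) :=
    ⟨fun x y => by simp only [Pi.add_apply]; ring,
      fun r x => by simp only [Pi.smul_apply, smul_eq_mul]; ring⟩
  exact convexHull_min (t := {v : ι → ℝ | a * v i + b * v j ≤ c}) h
    (convex_halfSpace_le hlin c) hz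

/-- If the level `t` separates the moduli of the coordinates of a point `z` of the convex hull
of `V ⊆ V_{π,y}`, then the vertex supported where `|z|` exceeds `t` belongs to `V`. -/
lemma exists_vertex_mem {k : ℕ} (hk : 1 ≤ k) {π : Equiv.Perm (Fin k)} {y : Fin k → ℝ}
    (hy : IsSign k y) {V : Set (Fin k → ℝ)} (hV : V ⊆ Vpy k π y) {z : Fin k → ℝ}
    (hz : z ∈ convexHull ℝ V) {t : ℝ} (ht0 : 0 ≤ t) (ht1 : t ≤ 1)
    (hsep : ∀ j, |z j| < t ∨ t < |z j|) :
    (fun j => if t < |z j| then Real.sign (z j) else 0) ∈ V := by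
  have hyy : ∀ j, y j * y j = 1 := fun j => by rcases hy j with h | h <;> simp [h]
  have hv : ∀ v ∈ V, ∃ i ≤ k, v = (fun j => indVec k π i j * y j) ∧
      ∀ p, y (π p) * v (π p) = if (p : ℕ) < i then 1 else 0 := by
    intro v hvV
    obtain ⟨i, hi, rfl⟩ := hV hvV
    refine ⟨i, hi, rfl, fun p => ?_⟩
    simp only [indVec, mem_chain_iff]
    split_ifs <;> simp [hyy]
  have hnonneg : ∀ p, 0 ≤ y (π p) * z (π p) := by
    intro p
    have := two_coord_le_of_mem_convexHull hz (π p) (π p) (-y (π p)) 0 0 (by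
      intro v hvV
      obtain ⟨i, -, -, h⟩ := hv v hvV
      have := h p
      split_ifs at this <;> linarith)
    linarith
  have hanti : ∀ p q : Fin k, p ≤ q → y (π q) * z (π q) ≤ y (π p) * z (π p) := by
    intro p q hpq
    have := two_coord_le_of_mem_convexHull hz (π q) (π p) (y (π q)) (-y (π p)) 0 (by
      intro v hvV
      obtain ⟨i, -, -, h⟩ := hv v hvV
      have h1 := h p
      have h2 := h q
      have : (p : ℕ) ≤ q := hpq
      split_ifs at h1 h2 <;> first | omega | linarith)
    linarith
  have habs : ∀ p, |z (π p)| = y (π p) * z (π p) := by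
    intro p
    rw [← abs_of_nonneg (hnonneg p), abs_mul]
    rcases hy (π p) with h | h <;> simp [h]
  have hex : ∃ m : ℕ, ∀ p : Fin k, m ≤ p → |z (π p)| < t :=
    ⟨k, fun p hp => absurd p.2 (by omega)⟩
  obtain ⟨m, hm, hmin⟩ : ∃ m : ℕ, (∀ p : Fin k, m ≤ p → |z (π p)| < t) ∧
      ∀ n < m, ¬ ∀ p : Fin k, n ≤ p → |z (π p)| < t :=
    ⟨Nat.find hex, Nat.find_spec hex, fun n hn => Nat.find_min hex hn⟩
  have hmk : m ≤ k := by
    by_contra hlt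
    exact hmin k (by omega) fun p hp => absurd p.2 (by omega)
  have hbelow : ∀ p : Fin k, (p : ℕ) < m → t < |z (π p)| := by
    intro p hp
    have := hmin p hp
    push Not at this
    obtain ⟨q, hq, htq⟩ := this
    have h1 := hanti p q hq
    rw [← habs, ← habs] at h1
    rcases hsep (π q) with h | h <;> linarith
  have hvm : (fun j => indVec k π m j * y j) ∈ V := by
    by_contra hnot
    have hne : ∀ v ∈ V, ∃ i ≤ k, i ≠ m ∧
        ∀ p, y (π p) * v (π p) = if (p : ℕ) < i then 1 else 0 := by
      intro v hvV
      obtain ⟨i, hi, hvi, h⟩ := hv v hvV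
      exact ⟨i, hi, fun him => hnot (by rw [← him, ← hvi]; exact hvV), h⟩
    rcases Nat.eq_zero_or_pos m with rfl | hpos
    · have h1 := hm ⟨0, hk⟩ (by simp)
      have := two_coord_le_of_mem_convexHull hz (π ⟨0, hk⟩) (π ⟨0, hk⟩)
        (-y (π ⟨0, hk⟩)) 0 (-1) (by
          intro v hvV
          obtain ⟨i, -, hi, h⟩ := hne v hvV
          have h2 := h ⟨0, hk⟩
          rw [if_pos (Nat.pos_of_ne_zero hi)] at h2
          linarith)
      rw [habs] at h1
      linarith
    · have hlast : m - 1 < k := by omega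
      have h1 := hbelow ⟨m - 1, hlast⟩ (by simp only; omega)
      rw [habs] at h1
      rcases hmk.eq_or_lt with hmk' | hmk'
      · have := two_coord_le_of_mem_convexHull hz (π ⟨m - 1, hlast⟩) (π ⟨m - 1, hlast⟩)
          (y (π ⟨m - 1, hlast⟩)) 0 0 (by
            intro v hvV
            obtain ⟨i, hik, hi, h⟩ := hne v hvV
            have h2 := h ⟨m - 1, hlast⟩
            rw [if_neg (by simp only; omega)] at h2
            linarith)
        linarith
      · have h3 := hm ⟨m, hmk'⟩ le_rfl
        rw [habs] at h3
        have := two_coord_le_of_mem_convexHull hz (π ⟨m - 1, hlast⟩) (π ⟨m, hmk'⟩)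
          (y (π ⟨m - 1, hlast⟩)) (-y (π ⟨m, hmk'⟩)) 0 (by
            intro v hvV
            obtain ⟨i, hik, hi, h⟩ := hne v hvV
            have h2 := h ⟨m - 1, hlast⟩
            have h4 := h ⟨m, hmk'⟩
            simp only at h2 h4
            split_ifs at h2 h4 <;> first | omega | linarith)
        linarith
  convert hvm using 1
  funext j
  obtain ⟨p, rfl⟩ := π.surjective j
  simp only [indVec, mem_chain_iff]
  by_cases hp : (p : ℕ) < m
  · have h1 := hbelow p hp
    rw [if_pos h1, if_pos hp, one_mul]
    rw [habs] at h1
    rcases hy (π p) with h | h <;> rw [h] at h1 ⊢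
    · exact Real.sign_of_pos (by linarith)
    · exact Real.sign_of_neg (by linarith)
  · have h1 := hm p (by omega)
    rw [if_neg (by linarith), if_neg hp, zero_mul]

/-- By pigeonhole, one of the levels `i / k`, `0 ≤ i ≤ k`, is `ε`-far from `k` given reals. -/
lemma exists_separating_level {k : ℕ} (hk : 1 ≤ k) {ε : ℝ} (hε : ε ≤ 1 / (2 * (k : ℝ)))
    (a : Fin k → ℝ) : ∃ t : ℝ, 0 ≤ t ∧ t ≤ 1 ∧ ∀ j, ε ≤ |a j - t| := by
  have hk0 : (0 : ℝ) < k := by exact_mod_cast hk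
  by_contra! hcon
  have hclose : ∀ i : Fin (k + 1), ∃ j, |a j - (i : ℕ) / (k : ℝ)| < ε := by
    intro i
    refine hcon _ (by positivity) ((div_le_one hk0).2 ?_)
    exact_mod_cast Nat.lt_succ_iff.1 i.2
  choose f hf using hclose
  obtain ⟨i, i', hii, hfi⟩ := Fintype.exists_ne_map_eq_of_card_lt f (by simp)
  wlog hlt : i < i' generalizing i i'
  · exact this i' i hii.symm hfi.symm (lt_of_le_of_ne (not_lt.1 hlt) hii.symm)
  have h1 := abs_lt.1 (hf i)
  have h2 := abs_lt.1 (hf i')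
  rw [← hfi] at h2
  have h3 : ((i : ℕ) : ℝ) + 1 ≤ ((i' : ℕ) : ℝ) := by exact_mod_cast hlt
  have h4 : ((i : ℕ) : ℝ) / k + 1 / k ≤ ((i' : ℕ) : ℝ) / k := by
    rw [← add_div]; gcongr
  have h5 : 1 / (2 * (k : ℝ)) = 1 / k / 2 := by field_simp
  linarith [h1.2, h2.1]

lemma psiHat_nonempty_of_le {k : ℕ} (hk : 1 ≤ k) {ε : ℝ} (hε : ε ≤ 1 / (2 * (k : ℝ)))
    (u : Fin k → ℝ) : (psiHat k ε u).Nonempty := by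
  obtain ⟨t, ht0, ht1, ht⟩ := exists_separating_level hk hε fun j => |clip k u j|
  refine ⟨fun j => if t < |clip k u j| then Real.sign (clip k u j) else 0, ?_⟩
  rintro V ⟨⟨π, y, hy, hV⟩, hd⟩
  obtain ⟨z, hz, hdz⟩ := Metric.infEDist_lt_iff.1 hd
  generalize clip k u = x at *
  rw [edist_dist, ENNReal.ofReal_lt_ofReal_iff_of_nonneg dist_nonneg] at hdz
  have hclose : ∀ j, |x j - z j| < ε := fun j =>
    ((Real.dist_eq _ _).symm.trans_le (dist_le_pi_dist x z j)).trans_lt hdz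
  have hcmp : ∀ j, (|z j| < t ∧ |x j| < t) ∨ (t < |z j| ∧ t < |x j| ∧ ε ≤ |x j|) := by
    intro j
    have h1 := (abs_abs_sub_abs_le_abs_sub (x j) (z j)).trans_lt (hclose j)
    have h2 := (abs_nonneg _).trans_lt (hclose j)
    rw [abs_lt] at h1
    rcases le_abs.1 (ht j) with h | h
    · exact Or.inr ⟨by linarith, by linarith, by linarith⟩
    · exact Or.inl ⟨by linarith, by linarith⟩
  convert exists_vertex_mem hk hy hV hz ht0 ht1
    (fun j => (hcmp j).imp And.left And.left) using 1
  funext j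
  rcases hcmp j with ⟨h1, h2⟩ | ⟨h1, h2, h3⟩
  · rw [if_neg (by linarith), if_neg (by linarith)]
  · rw [if_pos h1, if_pos h2]
    have h4 := abs_lt.1 (hclose j)
    have h5 := (abs_nonneg _).trans_lt (hclose j)
    rcases le_abs.1 h3 with h | h
    · rw [Real.sign_of_pos (by linarith), Real.sign_of_pos (by linarith)]
    · rw [Real.sign_of_neg (by linarith), Real.sign_of_neg (by linarith)]

/-- The average of all vertices of `P_{id,1}` but the `i`-th one, coordinatewise. -/
lemma average_erase_mem_convexHull {k : ℕ} (hk : 1 ≤ k) {i : ℕ} (hi : i ≤ k) :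
    (fun j : Fin k => ((k : ℝ) - (j : ℕ) - if (j : ℕ) < i then 1 else 0) / k) ∈
      convexHull ℝ (Vpy k 1 1 \ {fun j => indVec k 1 i j * (1 : Fin k → ℝ) j}) := by
  have hk0 : (k : ℝ) ≠ 0 := by positivity
  have hind : ∀ (l : ℕ) (j : Fin k), indVec k 1 l j = if (j : ℕ) < l then 1 else 0 := by
    intro l j
    simp only [indVec]
    exact if_congr (mem_chain_iff 1 l j) rfl rfl
  have hmem : i ∈ range (k + 1) := by simp; omega
  have h := (convex_convexHull ℝ
    (Vpy k 1 1 \ {fun j => indVec k 1 i j * (1 : Fin k → ℝ) j})).sum_mem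
    (t := (range (k + 1)).erase i) (w := fun _ => 1 / (k : ℝ))
    (z := fun l j => indVec k 1 l j * (1 : Fin k → ℝ) j)
    (fun _ _ => by positivity)
    (by simp [Finset.card_erase_of_mem hmem, hk0])
    (by
      intro l hl
      simp only [Finset.mem_erase, Finset.mem_range] at hl
      refine subset_convexHull ℝ _ ⟨⟨l, by omega, rfl⟩, fun heq => ?_⟩
      have hj : min l i < k := by omega
      have := congrFun heq ⟨min l i, hj⟩
      simp only [hind, Pi.one_apply, mul_one] at this
      split_ifs at this <;> first | omega | norm_num at this)
  convert h using 1
  funext j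
  have hj := j.2
  have hcard : ((range (k + 1)).filter fun l => (j : ℕ) < l).card = k - j := by
    have : ((range (k + 1)).filter fun l => (j : ℕ) < l) = Finset.Ioc (j : ℕ) k := by
      ext l
      simp only [Finset.mem_filter, Finset.mem_range, Finset.mem_Ioc]
      omega
    rw [this, Nat.card_Ioc]
  have hsum : ∑ l ∈ range (k + 1), (if (j : ℕ) < l then (1 : ℝ) else 0) = (k : ℝ) - (j : ℕ) := by
    rw [Finset.sum_boole, hcard, Nat.cast_sub hj.le]
  have herase := Finset.add_sum_erase _ (fun l => if (j : ℕ) < l then (1 : ℝ) else 0) hmem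
  rw [Finset.sum_apply]
  simp only [Pi.smul_apply, smul_eq_mul, hind, Pi.one_apply, mul_one]
  rw [← Finset.mul_sum, ← hsum, ← herase]
  ring

lemma psiHat_eq_empty_of_lt {k : ℕ} (hk : 1 ≤ k) {ε : ℝ} (hε : 1 / (2 * (k : ℝ)) < ε) :
    psiHat k ε (fun j : Fin k => ((k : ℝ) - (j : ℕ) - 1 / 2) / k) = ∅ := by
  have hk0 : (0 : ℝ) < k := by exact_mod_cast hk
  have hclip : clip k (fun j : Fin k => ((k : ℝ) - (j : ℕ) - 1 / 2) / k) =
      fun j : Fin k => ((k : ℝ) - (j : ℕ) - 1 / 2) / k := by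
    funext j
    have hj : ((j : ℕ) : ℝ) + 1 ≤ k := by exact_mod_cast j.2
    have hj0 : (0 : ℝ) ≤ (j : ℕ) := by positivity
    have hpos : 0 < ((k : ℝ) - (j : ℕ) - 1 / 2) / k := div_pos (by linarith) hk0
    have hle : ((k : ℝ) - (j : ℕ) - 1 / 2) / k ≤ 1 := (div_le_one hk0).2 (by linarith)
    simp only [clip]
    rw [Real.sign_of_pos hpos, abs_of_pos hpos, min_eq_left hle, one_mul]
  have hmem : ∀ x ∈ psiHat k ε (fun j : Fin k => ((k : ℝ) - (j : ℕ) - 1 / 2) / k), ∀ i ≤ k,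
      x ∈ Vpy k 1 1 \ {fun j => indVec k 1 i j * (1 : Fin k → ℝ) j} := by
    intro x hx i hi
    refine hx _ ⟨⟨1, 1, fun _ => Or.inl rfl, Set.sdiff_subset⟩, ?_⟩
    refine (Metric.infEDist_le_edist_of_mem (average_erase_mem_convexHull hk hi)).trans_lt ?_
    rw [hclip, edist_dist]
    refine (ENNReal.ofReal_lt_ofReal_iff (lt_trans (by positivity) hε)).2
      (lt_of_le_of_lt ((dist_pi_le_iff (by positivity)).2 fun j => ?_) hε)
    rw [Real.dist_eq, ← sub_div, abs_div, abs_of_pos hk0, ← div_div]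
    gcongr
    split_ifs <;> rw [abs_le] <;> constructor <;> linarith
  refine Set.eq_empty_of_forall_notMem fun x hx => ?_
  obtain ⟨i, hi, hxi⟩ := (hmem x hx 0 (Nat.zero_le k)).1
  exact (hmem x hx i hi).2 hxi

/-- The link envelope `Ψ̂(u)` is nonempty for every `u` iff `ε ≤ 1/(2k)`. -/
theorem psiHat_nonempty_iff (k : ℕ) (hk : 1 ≤ k) (ε : ℝ) (hε : 0 < ε) :
    (∀ u : Fin k → ℝ, (psiHat k ε u).Nonempty) ↔ ε ≤ 1 / (2 * (k : ℝ)) := by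
  refine ⟨fun h => ?_, fun h u => psiHat_nonempty_of_le hk h u⟩
  by_contra! hlt
  have hne := h fun j : Fin k => ((k : ℝ) - (j : ℕ) - 1 / 2) / k
  rw [psiHat_eq_empty_of_lt hk hlt] at hne
  exact Set.not_nonempty_empty hne

end
end

section
/- Let k ≥ 1 and ε > 0. For all u ∈ ℝ^k, y ∈ {−1,1}^k, and every permutation π of [k], the link envelope satisfies Ψ̂(π(u ⊙ y)) = π(Ψ̂(u) ⊙ y), where (π x)_i = x_{π_i} for x ∈ ℝ^k and these operations are applied elementwise to sets. -/
open Finset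
open scoped Classical

noncomputable section

/-- The signed permutation `x ↦ π (x ⊙ y)` as a linear map on `ℝ^k`. -/
def signedPerm (k : ℕ) (π : Equiv.Perm (Fin k)) (y : Fin k → ℝ) :
    (Fin k → ℝ) →ₗ[ℝ] (Fin k → ℝ) where
  toFun x i := x (π i) * y (π i)
  map_add' a b := by ext i; simp [add_mul]
  map_smul' c a := by ext i; simp [mul_assoc]

lemma signedPerm_apply (k : ℕ) (π : Equiv.Perm (Fin k)) (y x : Fin k → ℝ) (i : Fin k) :
    signedPerm k π y x i = x (π i) * y (π i) := rfl

lemma IsSign.mul_self {k : ℕ} {y : Fin k → ℝ} (hy : IsSign k y) (i : Fin k) :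
    y i * y i = 1 := by
  rcases hy i with h | h <;> simp [h]

lemma IsSign.comp_perm {k : ℕ} {y : Fin k → ℝ} (hy : IsSign k y) (π : Equiv.Perm (Fin k)) :
    IsSign k (fun i => y (π i)) := fun i => hy (π i)

lemma IsSign.mul {k : ℕ} {y z : Fin k → ℝ} (hy : IsSign k y) (hz : IsSign k z) :
    IsSign k (fun i => y i * z i) := by
  intro i
  rcases hy i with h | h <;> rcases hz i with h' | h' <;> simp [h, h']

lemma signedPerm_symm_apply {k : ℕ} (π : Equiv.Perm (Fin k)) {y : Fin k → ℝ}
    (hy : IsSign k y) (x : Fin k → ℝ) :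
    signedPerm k π⁻¹ (fun i => y (π i)) (signedPerm k π y x) = x := by
  ext i
  simp [signedPerm_apply, mul_assoc, hy.mul_self]

lemma signedPerm_apply_symm {k : ℕ} (π : Equiv.Perm (Fin k)) {y : Fin k → ℝ}
    (hy : IsSign k y) (x : Fin k → ℝ) :
    signedPerm k π y (signedPerm k π⁻¹ (fun i => y (π i)) x) = x := by
  ext i
  simp [signedPerm_apply, mul_assoc, hy.mul_self]

lemma isometry_signedPerm {k : ℕ} (π : Equiv.Perm (Fin k)) {y : Fin k → ℝ}
    (hy : IsSign k y) : Isometry (signedPerm k π y) := by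
  refine AddMonoidHomClass.isometry_of_norm _ fun x => ?_
  have habs (i : Fin k) : ‖x i * y i‖ = ‖x i‖ := by
    rcases hy i with h | h <;> simp [h]
  refine le_antisymm ?_ ?_ <;> refine (pi_norm_le_iff_of_nonneg (norm_nonneg _)).2 fun i => ?_
  · rw [signedPerm_apply, habs]
    exact norm_le_pi_norm x (π i)
  · have := norm_le_pi_norm (signedPerm k π y x) (π⁻¹ i)
    simpa only [signedPerm_apply, habs, Equiv.Perm.inv_def, Equiv.apply_symm_apply] using this

lemma clip_signedPerm {k : ℕ} (π : Equiv.Perm (Fin k)) {y : Fin k → ℝ}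
    (hy : IsSign k y) (u : Fin k → ℝ) :
    clip k (signedPerm k π y u) = signedPerm k π y (clip k u) := by
  ext i
  simp only [clip, signedPerm_apply]
  rcases hy (π i) with h | h <;> simp [h, Real.sign_neg]

lemma indVec_perm_mul {k : ℕ} (π σ : Equiv.Perm (Fin k)) (i : ℕ) (j : Fin k) :
    indVec k (π⁻¹ * σ) i j = indVec k σ i (π j) := by
  simp only [indVec, chain, Finset.mem_image, Equiv.Perm.mul_apply, Equiv.Perm.inv_eq_iff_eq]

lemma image_signedPerm_subset_Vpy {k : ℕ} (π σ : Equiv.Perm (Fin k)) (y z : Fin k → ℝ) :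
    signedPerm k π y '' Vpy k σ z ⊆ Vpy k (π⁻¹ * σ) (fun i => z (π i) * y (π i)) := by
  rintro _ ⟨_, ⟨i, hi, rfl⟩, rfl⟩
  refine ⟨i, hi, ?_⟩
  ext j
  simp only [signedPerm_apply, indVec_perm_mul, mul_assoc]

lemma infEdist_clip_image_signedPerm {k : ℕ} (π : Equiv.Perm (Fin k)) {y : Fin k → ℝ}
    (hy : IsSign k y) (u : Fin k → ℝ) (V : Set (Fin k → ℝ)) :
    Metric.infEDist (clip k (signedPerm k π y u)) (convexHull ℝ (signedPerm k π y '' V)) =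
      Metric.infEDist (clip k u) (convexHull ℝ V) := by
  rw [clip_signedPerm π hy, ← (signedPerm k π y).image_convexHull,
    Metric.infEDist_image (isometry_signedPerm π hy)]

lemma signedPerm_mem_psiHat {k : ℕ} {ε : ℝ} (π : Equiv.Perm (Fin k)) {y u x : Fin k → ℝ}
    (hy : IsSign k y) (hx : x ∈ psiHat k ε u) :
    signedPerm k π y x ∈ psiHat k ε (signedPerm k π y u) := by
  rintro V ⟨⟨σ, z, hz, hV⟩, hd⟩
  have hy' := hy.comp_perm π
  obtain ⟨v, hv, rfl⟩ : x ∈ signedPerm k π⁻¹ (fun i => y (π i)) '' V := by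
    refine hx _ ⟨⟨_, _, (hz.mul hy').comp_perm π⁻¹,
      (Set.image_mono hV).trans (image_signedPerm_subset_Vpy _ _ _ _)⟩, ?_⟩
    change Metric.infEDist _ _ < _
    rwa [← signedPerm_symm_apply π hy u, infEdist_clip_image_signedPerm _ hy']
  rwa [signedPerm_apply_symm π hy]

/-- Symmetry of the link envelope under signed permutations:
`Ψ̂(π(u ⊙ y)) = π(Ψ̂(u) ⊙ y)`, where `(π x)_i = x_{π_i}`. -/
theorem psiHat_symmetry (k : ℕ) (hk : 1 ≤ k) (ε : ℝ) (hε : 0 < ε)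
    (u y : Fin k → ℝ) (hy : IsSign k y) (π : Equiv.Perm (Fin k)) :
    psiHat k ε (fun i => u (π i) * y (π i)) =
      (fun x : Fin k → ℝ => fun i => x (π i) * y (π i)) '' psiHat k ε u := by
  change psiHat k ε (signedPerm k π y u) = signedPerm k π y '' psiHat k ε u
  refine Set.Subset.antisymm (fun z hz => ?_) ?_
  · refine ⟨_, ?_, signedPerm_apply_symm π hy z⟩
    simpa only [signedPerm_symm_apply π hy] using
      signedPerm_mem_psiHat π⁻¹ (hy.comp_perm π) hz
  · rintro _ ⟨x, hx, rfl⟩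
    exact signedPerm_mem_psiHat π hy hx

end
end

section
/- Let k ≥ 1, let u ∈ [−1,1]^k, and let π be a permutation of [k] and y ∈ {−1,1}^k with u ∈ P_{π,y} (so |u|_{π_1} ≥ … ≥ |u|_{π_k}). Define α_0 = 1 − |u|_{π_1}, α_i = |u|_{π_i} − |u|_{π_{i+1}} for 1 ≤ i ≤ k−1, and α_k = |u|_{π_k}, and let V^u = { 1_{π,i} ⊙ y : 0 ≤ i ≤ k, α_i ≠ 0 }. Then u ∈ conv(V^u), and V^u is the smallest-cardinality subset W of V_{π,y} with u ∈ conv(W); indeed V^u ⊆ W for every W ⊆ V_{π,y} with u ∈ conv(W). -/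
open Finset
open scoped Classical

noncomputable section

/-- The vertices of `V_{π,y}` carrying nonzero barycentric weight for `u`
(the weights are `α_i = m_i - m_{i+1}` with boundary conventions `m_0 = 1`, `m_{k+1} = 0`,
i.e. `mval` with `ε = 0`). -/
def Vu (k : ℕ) (u : Fin k → ℝ) (π : Equiv.Perm (Fin k)) (y : Fin k → ℝ) :
    Set (Fin k → ℝ) :=
  { x | ∃ i ≤ k, mval k 0 u π i - mval k 0 u π (i+1) ≠ 0 ∧
      x = fun j => indVec k π i j * y j }

/-- A point in the convex hull of a set `W` of vertices is a convex combination of the vertices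
of the chain, indexed by `0, …, k`, with vanishing weights outside `W`. -/
lemma exists_weights_of_mem_convexHull {k : ℕ} {π : Equiv.Perm (Fin k)} {y u : Fin k → ℝ}
    {W : Set (Fin k → ℝ)} (hW : W ⊆ Vpy k π y) (hu : u ∈ convexHull ℝ W) :
    ∃ w : ℕ → ℝ, (∀ i, 0 ≤ w i) ∧ ∑ i ∈ range (k + 1), w i = 1 ∧
      (∀ i, w i ≠ 0 → (fun j => indVec k π i j * y j) ∈ W) ∧
      ∀ j, u j = ∑ i ∈ range (k + 1), w i * (indVec k π i j * y j) := by
  let S : Set (Fin k → ℝ) := { u | ∃ w : ℕ → ℝ, (∀ i, 0 ≤ w i) ∧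
      ∑ i ∈ range (k + 1), w i = 1 ∧
      (∀ i, w i ≠ 0 → (fun j => indVec k π i j * y j) ∈ W) ∧
      ∀ j, u j = ∑ i ∈ range (k + 1), w i * (indVec k π i j * y j) }
  have hWS : W ⊆ S := by
    intro x hx
    obtain ⟨i, hi, rfl⟩ := hW hx
    have hi' : i ∈ range (k + 1) := by simpa using Nat.lt_succ_of_le hi
    refine ⟨fun l => if l = i then 1 else 0, fun l => ?_, ?_, fun l hl => ?_, fun j => ?_⟩
    · dsimp only
      split_ifs <;> norm_num
    · rw [Finset.sum_ite_eq' (range (k + 1)) i, if_pos hi']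
    · obtain rfl : l = i := by
        by_contra h
        simp [h] at hl
      exact hx
    · simp only [ite_mul, one_mul, zero_mul]
      rw [Finset.sum_ite_eq' (range (k + 1)) i, if_pos hi']
  have hS : Convex ℝ S := by
    rintro a ⟨w, hw0, hw1, hwW, hw⟩ b ⟨z, hz0, hz1, hzW, hz⟩ s t hs ht hst
    refine ⟨fun i => s * w i + t * z i,
      fun i => add_nonneg (mul_nonneg hs (hw0 i)) (mul_nonneg ht (hz0 i)), ?_,
      fun i hi => ?_, fun j => ?_⟩
    · rw [sum_add_distrib, ← mul_sum, ← mul_sum, hw1, hz1, mul_one, mul_one, hst]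
    · by_cases h : w i = 0
      · refine hzW i fun h' => hi ?_
        simp [h, h']
      · exact hwW i h
    · simp only [Pi.add_apply, Pi.smul_apply, smul_eq_mul, hw j, hz j, mul_sum,
        ← sum_add_distrib]
      exact sum_congr rfl fun i _ => by ring
  exact convexHull_min hWS hS hu

lemma indVec_apply_perm {k : ℕ} (π : Equiv.Perm (Fin k)) (i : ℕ) (j : Fin k) :
    indVec k π i (π j) = if (j : ℕ) < i then 1 else 0 := by
  simp [indVec, chain]

/-- The ordered absolute values of a convex combination are the tail sums of its weights. -/
lemma mval_eq_sum_tail {k : ℕ} {π : Equiv.Perm (Fin k)} {y u : Fin k → ℝ} (hy : IsSign k y)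
    {w : ℕ → ℝ} (hw0 : ∀ i, 0 ≤ w i) (hw1 : ∑ i ∈ range (k + 1), w i = 1)
    (hw : ∀ j, u j = ∑ i ∈ range (k + 1), w i * (indVec k π i j * y j))
    {i : ℕ} (hi : i ≤ k + 1) :
    mval k 0 u π i = ∑ l ∈ Ico i (k + 1), w l := by
  rcases Nat.eq_zero_or_pos i with rfl | hpos
  · simpa [mval] using hw1.symm
  rcases hi.eq_or_lt with rfl | hlt
  · simp [mval]
  have hik : i ≤ k ∧ 1 ≤ k := by omega
  have hu : u (π ⟨i - 1, by omega⟩) =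
      (∑ l ∈ Ico i (k + 1), w l) * y (π ⟨i - 1, by omega⟩) := by
    have hIco : Ico i (k + 1) = (range (k + 1)).filter (fun l => i - 1 < l) := by
      ext l
      simp only [mem_Ico, mem_filter, mem_range]
      omega
    rw [hw, hIco, sum_filter, sum_mul]
    refine sum_congr rfl fun l _ => ?_
    rw [indVec_apply_perm]
    split_ifs <;> simp
  have hyabs : |y (π ⟨i - 1, by omega⟩)| = 1 := by
    rcases hy (π ⟨i - 1, by omega⟩) with h | h <;> simp [h]
  rw [mval, if_neg hpos.ne', dif_pos hik, hu, abs_mul, hyabs, mul_one,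
    abs_of_nonneg (sum_nonneg fun l _ => hw0 l)]

/-- The weights of a convex combination of the vertices of the chain are the barycentric
weights `mval i - mval (i + 1)`. -/
lemma mval_sub_mval_succ {k : ℕ} {π : Equiv.Perm (Fin k)} {y u : Fin k → ℝ} (hy : IsSign k y)
    {w : ℕ → ℝ} (hw0 : ∀ i, 0 ≤ w i) (hw1 : ∑ i ∈ range (k + 1), w i = 1)
    (hw : ∀ j, u j = ∑ i ∈ range (k + 1), w i * (indVec k π i j * y j))
    {i : ℕ} (hi : i ≤ k) :
    mval k 0 u π i - mval k 0 u π (i + 1) = w i := by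
  rw [mval_eq_sum_tail hy hw0 hw1 hw (by omega), mval_eq_sum_tail hy hw0 hw1 hw (by omega),
    sum_eq_sum_Ico_succ_bot (by omega : i < k + 1), add_sub_cancel_right]

/-- For `u ∈ P_{π,y}`, the set `V^u` of vertices with nonzero weight
satisfies `u ∈ conv(V^u)`, and `V^u ⊆ W` for every `W ⊆ V_{π,y}` with `u ∈ conv(W)`;
in particular `V^u` is the smallest-cardinality such subset. -/
theorem Vu_minimal (k : ℕ) (hk : 1 ≤ k) (u : Fin k → ℝ)
    (π : Equiv.Perm (Fin k)) (y : Fin k → ℝ) (hy : IsSign k y)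
    (hu : u ∈ Ppy k π y) :
    u ∈ convexHull ℝ (Vu k u π y) ∧
    ∀ W ⊆ Vpy k π y, u ∈ convexHull ℝ W → Vu k u π y ⊆ W := by
  constructor
  · obtain ⟨w, hw0, hw1, -, hw⟩ := exists_weights_of_mem_convexHull subset_rfl hu
    have hsum : ∑ i ∈ (range (k + 1)).filter (fun i => w i ≠ 0), w i = 1 := by
      rw [sum_filter_ne_zero, hw1]
    have hcomb : u = ∑ i ∈ (range (k + 1)).filter (fun i => w i ≠ 0),
        w i • (fun j => indVec k π i j * y j) := by
      ext j
      rw [sum_filter_of_ne fun i _ h => left_ne_zero_of_smul h]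
      simp [hw j]
    refine Set.mem_of_eq_of_mem hcomb
      ((convex_convexHull ℝ _).sum_mem (fun i _ => hw0 i) hsum fun i hi => ?_)
    obtain ⟨hik, hwi⟩ := mem_filter.mp hi
    have hik : i ≤ k := Nat.lt_succ_iff.mp (mem_range.mp hik)
    exact subset_convexHull ℝ _
      ⟨i, hik, by rwa [mval_sub_mval_succ hy hw0 hw1 hw hik], rfl⟩
  · rintro W hW huW x ⟨i, hi, hne, rfl⟩
    obtain ⟨w, hw0, hw1, hwW, hw⟩ := exists_weights_of_mem_convexHull hW huW
    rw [mval_sub_mval_succ hy hw0 hw1 hw hi] at hne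
    exact hwW i hne

end
end

section
/- Let L : ℝ^k → ℝ be a polyhedral function (a pointwise maximum of finitely many affine functions) and let C ⊆ ℝ^k be a convex set on which L is affine, i.e., there exist w' ∈ ℝ^k and b ∈ ℝ with L(z) = ⟨w', z⟩ + b for all z ∈ C. Then for every x in the relative interior of C and every z ∈ C, every subgradient of L at x is a subgradient of L at z, where w is a subgradient of L at x if L(v) ≥ L(x) + ⟨w, v − x⟩ for all v ∈ ℝ^k. -/
open Finset
open scoped Classical

noncomputable section

/-- A segment from a point of `C` to a point of its relative interior can be prolonged
within `C` beyond that interior point. -/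
theorem exists_lineMap_neg_mem_of_mem_intrinsicInterior {E : Type*} [AddCommGroup E]
    [Module ℝ E] [TopologicalSpace E] [IsTopologicalAddGroup E] [ContinuousSMul ℝ E]
    {C : Set E} {x z : E} (hx : x ∈ intrinsicInterior ℝ C) (hz : z ∈ C) :
    ∃ t : ℝ, 0 < t ∧ AffineMap.lineMap x z (-t) ∈ C := by
  have hxC : x ∈ affineSpan ℝ C := subset_affineSpan ℝ C (intrinsicInterior_subset hx)
  have hzC : z ∈ affineSpan ℝ C := subset_affineSpan ℝ C hz
  obtain ⟨y, hy, rfl⟩ := mem_intrinsicInterior.1 hx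
  let g : ℝ → affineSpan ℝ C := fun s =>
    ⟨AffineMap.lineMap (y : E) z (-s), AffineMap.lineMap_mem _ hxC hzC⟩
  have hg : Continuous g :=
    Continuous.subtype_mk (AffineMap.lineMap_continuous.comp continuous_neg) _
  have hg0 : g 0 = y := Subtype.ext (by simp [g])
  have hmem : g ⁻¹' interior ((↑) ⁻¹' C) ∈ nhds (0 : ℝ) :=
    (isOpen_interior.preimage hg).mem_nhds (by rwa [Set.mem_preimage, hg0])
  obtain ⟨ε, hε, hball⟩ := Metric.mem_nhds_iff.1 hmem
  have hε2 : ε / 2 ∈ Metric.ball (0 : ℝ) ε := by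
    rw [Metric.mem_ball, Real.dist_eq, sub_zero, abs_of_pos (half_pos hε)]
    exact half_lt_self hε
  have hgC : g (ε / 2) ∈ ((↑) ⁻¹' C : Set (affineSpan ℝ C)) := interior_subset (hball hε2)
  exact ⟨ε / 2, half_pos hε, hgC⟩

/-- If `L` is polyhedral and affine on a convex set `C` (with affine form
`⟨w',·⟩ + b'`), then every subgradient of `L` at a point `x` in the relative (intrinsic)
interior of `C` is a subgradient of `L` at every `z ∈ C`. -/
theorem subgradient_transfer (k : ℕ) (L : (Fin k → ℝ) → ℝ) (n : ℕ)
    (a : Fin (n+1) → Fin k → ℝ) (b : Fin (n+1) → ℝ)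
    (hL : ∀ x : Fin k → ℝ,
      L x = Finset.univ.sup' Finset.univ_nonempty
        (fun j : Fin (n+1) => ∑ i, a j i * x i + b j))
    (C : Set (Fin k → ℝ)) (hC : Convex ℝ C)
    (w' : Fin k → ℝ) (b' : ℝ) (haff : ∀ z ∈ C, L z = ∑ i, w' i * z i + b')
    (x : Fin k → ℝ) (hx : x ∈ intrinsicInterior ℝ C) (z : Fin k → ℝ) (hz : z ∈ C)
    (w : Fin k → ℝ) (hw : ∀ v : Fin k → ℝ, L x + ∑ i, w i * (v i - x i) ≤ L v) :
    ∀ v : Fin k → ℝ, L z + ∑ i, w i * (v i - z i) ≤ L v := by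
  intro v
  obtain ⟨t, ht, hp⟩ := exists_lineMap_neg_mem_of_mem_intrinsicInterior hx hz
  set p : Fin k → ℝ := AffineMap.lineMap x z (-t) with hpdef
  have hpi (i : Fin k) : p i = x i - t * (z i - x i) := by
    simp [hpdef, AffineMap.lineMap_apply]
    ring
  have hLp := haff p hp
  have hLx := haff x (intrinsicInterior_subset hx)
  have hLz := haff z hz
  have hw'p : ∑ i, w' i * p i = ∑ i, w' i * x i - t * (∑ i, w' i * z i - ∑ i, w' i * x i) := by
    rw [← Finset.sum_sub_distrib, Finset.mul_sum, ← Finset.sum_sub_distrib]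
    exact Finset.sum_congr rfl fun i _ => by rw [hpi]; ring
  have hwp : ∑ i, w i * (p i - x i) = -(t * ∑ i, w i * (z i - x i)) := by
    rw [Finset.mul_sum, ← Finset.sum_neg_distrib]
    exact Finset.sum_congr rfl fun i _ => by rw [hpi]; ring
  have hwv : ∑ i, w i * (v i - x i) = ∑ i, w i * (v i - z i) + ∑ i, w i * (z i - x i) := by
    rw [← Finset.sum_add_distrib]
    exact Finset.sum_congr rfl fun i _ => by ring
  have hle : L z - L x ≤ ∑ i, w i * (z i - x i) := by
    refine le_of_mul_le_mul_left ?_ ht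
    have hsub := hw p
    rw [hwp, hLp, hw'p] at hsub
    rw [hLx] at hsub
    rw [hLz, hLx]
    linarith
  linarith [hw v]

end
end

section
/- Let k, d ≥ 1 and for each y ∈ {−1,1}^{dk} let g_y be a polymatroid on 2^{[k]}. For i ∈ [k] let B_i = {d(i−1)+1, …, di} ⊆ [dk], and define f_y : 2^{[dk]} → ℝ by f_y(S) = g_y({ i ∈ [k] : S ∩ B_i ≠ ∅ }). Let y ∈ {−1,1}^{dk} and v ∈ {−1,0,1}^{dk} with v_j = 0 for some j ∈ B_i, and let v' ∈ {−1,0,1}^{dk} agree with v outside B_i and be 0 on all of B_i. Then ℓ_abs^{f}(v', y) ≤ ℓ_abs^{f}(v, y), where ℓ_abs^{f}(v,y) = f_y(mis(v,y) \ abs(v)) + f_y(mis(v,y)); i.e., abstaining on an entire block weakly dominates partially abstaining within it. -/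
open Finset
open scoped Classical

noncomputable section

/-- Misprediction set over the index set `[k] × [d]` (i.e. `[dk]` split into `k` blocks of
size `d`, block `i` being `{i} × [d]`). -/
def misP (k d : ℕ) (v y : Fin k × Fin d → ℝ) : Finset (Fin k × Fin d) :=
  Finset.univ.filter (fun j => v j ≠ y j)

def absP (k d : ℕ) (v : Fin k × Fin d → ℝ) : Finset (Fin k × Fin d) :=
  Finset.univ.filter (fun j => v j = 0)

def IsSignP (k d : ℕ) (y : Fin k × Fin d → ℝ) : Prop := ∀ j, y j = 1 ∨ y j = -1

def IsVP (k d : ℕ) (v : Fin k × Fin d → ℝ) : Prop := ∀ j, v j = -1 ∨ v j = 0 ∨ v j = 1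

/-- `f_y(S) = g_y({i ∈ [k] : S ∩ B_i ≠ ∅})`, the blockwise lift of a set function on `[k]`
to one on `[k] × [d]`. -/
def blockLift (k d : ℕ) (g : Finset (Fin k) → ℝ) : Finset (Fin k × Fin d) → ℝ :=
  fun S => g (S.image Prod.fst)

theorem IsPolymatroid.mono {k : ℕ} {f : Finset (Fin k) → ℝ} (hf : IsPolymatroid k f)
    {S T : Finset (Fin k)} (hST : S ⊆ T) : f S ≤ f T := by
  simpa [Finset.union_sdiff_of_subset hST] using hf.2.1 S (T \ S) Finset.disjoint_sdiff

/-- Abstaining on an entire block weakly dominates partially abstaining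
within it: if `v` has a zero in block `i` and `v'` agrees with `v` outside block `i` and is
zero on all of block `i`, then `ℓ_abs^f(v', y) ≤ ℓ_abs^f(v, y)`, where
`f_y(S) = g_y({i : S ∩ B_i ≠ ∅})` for polymatroids `g_y` on `2^[k]`. -/
theorem block_abstain_dominates (k d : ℕ) (hk : 1 ≤ k) (hd : 1 ≤ d)
    (g : (Fin k × Fin d → ℝ) → Finset (Fin k) → ℝ)
    (hg : ∀ y : Fin k × Fin d → ℝ, IsSignP k d y → IsPolymatroid k (g y))
    (y : Fin k × Fin d → ℝ) (hy : IsSignP k d y)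
    (v v' : Fin k × Fin d → ℝ) (hv : IsVP k d v) (hv' : IsVP k d v')
    (i : Fin k) (j0 : Fin k × Fin d) (hj0 : j0.1 = i) (hvj0 : v j0 = 0)
    (h1 : ∀ j : Fin k × Fin d, j.1 = i → v' j = 0)
    (h2 : ∀ j : Fin k × Fin d, j.1 ≠ i → v' j = v j) :
    blockLift k d (g y) (misP k d v' y \ absP k d v') + blockLift k d (g y) (misP k d v' y)
      ≤ blockLift k d (g y) (misP k d v y \ absP k d v)
          + blockLift k d (g y) (misP k d v y) := by
  have hy0 : ∀ j, y j ≠ 0 := fun j => by rcases hy j with h | h <;> rw [h] <;> norm_num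
  refine add_le_add ((hg y hy).mono (Finset.image_subset_image ?_)) ((hg y hy).mono ?_)
  · intro j hj
    simp only [misP, absP, Finset.mem_sdiff, Finset.mem_filter, Finset.mem_univ, true_and] at hj ⊢
    have hji : j.1 ≠ i := fun h => hj.2 (h1 j h)
    rwa [h2 j hji] at hj
  · intro a ha
    simp only [misP, Finset.mem_image, Finset.mem_filter, Finset.mem_univ, true_and] at ha ⊢
    obtain ⟨j, hj, rfl⟩ := ha
    by_cases hji : j.1 = i
    · exact ⟨j0, by rw [hvj0]; exact (hy0 j0).symm, hj0.trans hji.symm⟩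
    · exact ⟨j, by rwa [h2 j hji] at hj, rfl⟩

end
end
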